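/- Let k, n ≥ 3 be integers. Then ℚ(ζₖ + ζₖ⁻¹) ⊆ ℚ(ζₙ + ζₙ⁻¹) holds if and only if one of the following holds: k ∈ {3,4,6} (i.e. the degree-1 case), or k divides n, or (k is twice an odd number k = 2d with d odd and d divides n). -/

import Mathlib

open Complex IntermediateField

/-- A subfield containing `x + x⁻¹` contains `x ^ j + (x ^ j)⁻¹` for all `j`. -/
lemma pow_add_inv_pow_mem {F E : Type*} [Field F] [Field E] [Algebra F E]
    (K : IntermediateField F E) {x : E} (hx : x ≠ 0) (h : x + x⁻¹ ∈ K) (j : ℕ) :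
    x ^ j + (x ^ j)⁻¹ ∈ K := by
  induction j using Nat.twoStepInduction with
  | zero => simpa using K.add_mem K.one_mem K.one_mem
  | one => simpa using h
  | more j ih₀ ih₁ =>
    have key : x ^ (j + 2) + (x ^ (j + 2))⁻¹ =
        (x ^ (j + 1) + (x ^ (j + 1))⁻¹) * (x + x⁻¹) - (x ^ j + (x ^ j)⁻¹) := by
      field_simp
      ring
    rw [key]
    exact K.sub_mem (K.mul_mem ih₁ h) ih₀

lemma eq_or_mul_eq_one_of_add_inv_eq {E : Type*} [Field E] {x y : E} (hx : x ≠ 0) (hy : y ≠ 0)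
    (h : x + x⁻¹ = y + y⁻¹) : x = y ∨ x * y = 1 := by
  have key : (x - y) * (x * y - 1) = 0 := by
    field_simp at h
    linear_combination h
  exact (mul_eq_zero.1 key).imp sub_eq_zero.1 sub_eq_zero.1

/-- Let `x`, `y` be primitive roots of unity of orders `k`, `n` that are powers of a primitive
`m`-th root of unity. If `x + x⁻¹ ∈ ℚ(y)`, then every `b` prime to `m` with `b ≡ 1 [MOD n]` is
`±1` modulo `k`, because raising to the power `b` fixes `y`, hence `x + x⁻¹`. -/
lemma modEq_one_or_dvd_add_one_of_add_inv_mem {E : Type*} [Field E] [CharZero E] {z x y : E}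
    {k n m r s : ℕ} (hm : 0 < m) (hz : IsPrimitiveRoot z m) (hx : IsPrimitiveRoot x k)
    (hk : k ≠ 0) (hy : IsPrimitiveRoot y n) (hn : n ≠ 0) (hr : x = z ^ r) (hs : y = z ^ s)
    (hmem : x + x⁻¹ ∈ (ℚ⟮y⟯ : IntermediateField ℚ E))
    {b : ℕ} (hb : b.Coprime m) (hbn : b ≡ 1 [MOD n]) : b ≡ 1 [MOD k] ∨ k ∣ b + 1 := by
  have halg : IsAlgebraic ℚ y :=
    ⟨Polynomial.X ^ n - 1, Polynomial.X_pow_sub_C_ne_zero (Nat.pos_of_ne_zero hn) 1, by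
      simp [hy.pow_eq_one]⟩
  rw [← mem_toSubalgebra, adjoin_simple_toSubalgebra_of_isAlgebraic halg,
    Algebra.adjoin_singleton_eq_range_aeval] at hmem
  obtain ⟨P, hP⟩ := hmem
  replace hP : Polynomial.aeval y P = x + x⁻¹ := hP
  have hx0 : x ≠ 0 := hx.ne_zero hk
  let Q : Polynomial ℚ := Polynomial.X ^ (2 * r) + 1 - Polynomial.X ^ r *
    P.comp (Polynomial.X ^ s)
  have hQ : ∀ w : E, Polynomial.aeval w Q =
      w ^ (2 * r) + 1 - w ^ r * Polynomial.aeval (w ^ s) P := by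
    intro w
    simp [Q, Polynomial.aeval_comp]
  have hQz : Polynomial.aeval z Q = 0 := by
    rw [hQ, ← hs, hP, mul_comm 2 r, pow_mul, ← hr]
    field_simp
    ring
  have hQb : Polynomial.aeval (z ^ b) Q = 0 := by
    have hdvd : minpoly ℚ (z ^ b) ∣ Q := by
      rw [← Polynomial.cyclotomic_eq_minpoly_rat (hz.pow_of_coprime b hb) hm,
        Polynomial.cyclotomic_eq_minpoly_rat hz hm]
      exact minpoly.dvd ℚ z hQz
    exact Polynomial.aeval_eq_zero_of_dvd_aeval_eq_zero hdvd (minpoly.aeval ℚ _)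
  have hzs : (z ^ b) ^ s = y := by
    rw [← pow_mul, mul_comm, pow_mul, ← hs]
    simpa using pow_eq_pow_of_modEq hbn hy.pow_eq_one
  have hzr : (z ^ b) ^ r = x ^ b := by
    rw [← pow_mul, mul_comm, pow_mul, ← hr]
  rw [hQ, hzs, hP, mul_comm 2 r, pow_mul, hzr] at hQb
  have hsum : x ^ b + (x ^ b)⁻¹ = x + x⁻¹ := by
    field_simp
    field_simp at hQb
    linear_combination hQb
  rcases eq_or_mul_eq_one_of_add_inv_eq (pow_ne_zero b hx0) hx0 hsum with h | h
  · left
    rw [hx.eq_orderOf]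
    exact (hx.isOfFinOrder hk).pow_eq_pow_iff_modEq.1 (by simpa using h)
  · right
    rw [← pow_succ] at h
    exact hx.dvd_of_pow_eq_one _ h

/-- If every unit modulo `k` is `±1`, then `k ∈ {3, 4, 6}` (for `k ≥ 3`). -/
lemma eq_three_or_four_or_six_of_coprime {k : ℕ} (hk : 3 ≤ k)
    (h : ∀ a : ℕ, a.Coprime k → a ≡ 1 [MOD k] ∨ k ∣ a + 1) : k = 3 ∨ k = 4 ∨ k = 6 := by
  replace h : ∀ a : ℕ, a.Coprime k → 2 ≤ a → a ≤ k → k = a + 1 := by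
    intro a ha h2 hak
    rcases h a ha with h' | h'
    · have := Nat.le_of_dvd (by omega) ((Nat.modEq_iff_dvd' (by omega : 1 ≤ a)).1 h'.symm)
      omega
    · obtain ⟨c, hc⟩ := h'
      obtain rfl | rfl | hc2 : c = 0 ∨ c = 1 ∨ 2 ≤ c := by omega
      · omega
      · omega
      · nlinarith
  rcases Nat.even_or_odd' k with ⟨j, rfl | rfl⟩
  · rcases Nat.even_or_odd j with hj | hj
    · have := h (j + 1) (Nat.Coprime.mul_right (Nat.coprime_two_right.2 hj.add_one)
        (by simp)) (by omega) (by omega)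
      omega
    · have := h (j + 2) (Nat.Coprime.mul_right
        (Nat.coprime_two_right.2 (hj.add_even even_two))
        (by simpa using Nat.coprime_two_left.2 hj)) (by omega) (by omega)
      omega
  · have := h 2 (Nat.coprime_two_left.2 (by simp)) (by omega) (by omega)
    omega

/-- If every unit modulo `k` that is `1` modulo a divisor `g ≥ 3` is `±1`, then `k` and `g`
have the same totient. -/
lemma totient_eq_of_unitsMap_ker {k g : ℕ} (hk : k ≠ 0) (hg : 3 ≤ g) (hgk : g ∣ k)
    (h : ∀ a : ℕ, a.Coprime k → a ≡ 1 [MOD g] → a ≡ 1 [MOD k] ∨ k ∣ a + 1) :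
    g.totient = k.totient := by
  have : NeZero k := ⟨hk⟩
  have : NeZero g := ⟨by omega⟩
  have hinj : Function.Injective (ZMod.unitsMap hgk) := by
    rw [injective_iff_map_eq_one]
    intro u hu
    have hug : (u : ZMod k).val ≡ 1 [MOD g] := by
      have h1 := congrArg (Units.val) hu
      rw [ZMod.unitsMap_val, ZMod.cast_eq_val] at h1
      exact (ZMod.natCast_eq_natCast_iff _ _ _).1 (by simpa using h1)
    rcases h _ (ZMod.val_coe_unit_coprime u) hug with h' | h'
    · have := (ZMod.natCast_eq_natCast_iff _ _ _).2 h'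
      exact Units.ext (by simpa using this)
    · exfalso
      have h2 : g ∣ 1 + 1 :=
        (Nat.modEq_zero_iff_dvd).1 (((hug.add_right 1).symm).trans
          ((Nat.modEq_zero_iff_dvd).2 (hgk.trans h')))
      have := Nat.le_of_dvd (by norm_num) h2
      omega
  rw [← ZMod.card_units_eq_totient, ← ZMod.card_units_eq_totient]
  exact (Fintype.card_of_bijective ⟨hinj, ZMod.unitsMap_surjective hgk⟩).symm

/-- If every unit modulo `k` that is `1` modulo `gcd k n` is `±1`, then `k ∣ n`, up to a factor
of `2`, or `k ∈ {3, 4, 6}`. -/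
lemma dvd_or_eq_two_mul_odd_of_units {k n : ℕ} (hk : 3 ≤ k)
    (h : ∀ a : ℕ, a.Coprime k → a ≡ 1 [MOD k.gcd n] → a ≡ 1 [MOD k] ∨ k ∣ a + 1) :
    (k = 3 ∨ k = 4 ∨ k = 6) ∨ k ∣ n ∨ ∃ d : ℕ, Odd d ∧ k = 2 * d ∧ d ∣ n := by
  have hgk := Nat.gcd_dvd_left k n
  have hgn := Nat.gcd_dvd_right k n
  have hgpos : 0 < k.gcd n := Nat.gcd_pos_of_pos_left n (by omega)
  rcases Nat.lt_or_ge (k.gcd n) 3 with hg | hg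
  · refine Or.inl (eq_three_or_four_or_six_of_coprime hk fun a ha => h a ha ?_)
    obtain hg | hg : k.gcd n = 1 ∨ k.gcd n = 2 := by omega
    · rw [hg]
      exact Nat.modEq_one
    · rw [hg] at hgk ⊢
      exact Nat.odd_iff.1 (Nat.coprime_two_right.1 (ha.coprime_dvd_right hgk))
  · right
    have htot := totient_eq_of_unitsMap_ker (by omega) hg hgk h
    rcases Nat.even_or_odd (k.gcd n) with he | ho
    · exact Or.inl (he.eq_of_totient_eq_totient hgk htot ▸ hgn)
    · rcases Nat.eq_or_eq_of_totient_eq_totient hgk htot with h' | h'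
      · exact Or.inl (h' ▸ hgn)
      · exact Or.inr ⟨_, ho, h'.symm, hgn⟩

lemma exp_two_pi_div_eq_pow {k m r : ℕ} (hm : m = k * r) (hm0 : m ≠ 0) :
    Complex.exp (2 * Real.pi * Complex.I / k) = Complex.exp (2 * Real.pi * Complex.I / m) ^ r := by
  subst hm
  have hk : (k : ℂ) ≠ 0 := by exact_mod_cast left_ne_zero_of_mul hm0
  have hr : (r : ℂ) ≠ 0 := by exact_mod_cast right_ne_zero_of_mul hm0
  rw [← Complex.exp_nat_mul]
  congr 1
  push_cast
  field_simp

/-- `x + x⁻¹` is rational for a primitive root of unity `x` of order `3`, `4` or `6`. -/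
lemma add_inv_mem_of_three_or_four_or_six {E : Type*} [Field E] [CharZero E]
    (K : IntermediateField ℚ E) {x : E} {k : ℕ} (hx : IsPrimitiveRoot x k)
    (hk : k = 3 ∨ k = 4 ∨ k = 6) : x + x⁻¹ ∈ K := by
  have hx0 : x ≠ 0 := hx.ne_zero (by omega)
  have hroot := hx.isRoot_cyclotomic (by omega)
  rcases hk with rfl | rfl | rfl
  · rw [Polynomial.cyclotomic_three] at hroot
    simp only [Polynomial.IsRoot.def, Polynomial.eval_add, Polynomial.eval_pow,
      Polynomial.eval_X, Polynomial.eval_one] at hroot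
    have : x + x⁻¹ = -1 := by
      field_simp
      linear_combination hroot
    rw [this]
    exact K.neg_mem K.one_mem
  · have h2 : x ^ 2 = -1 := (hx.pow (by norm_num) (by norm_num : 4 = 2 * 2)).eq_neg_one_of_two_right
    have : x + x⁻¹ = 0 := by
      field_simp
      linear_combination h2
    rw [this]
    exact K.zero_mem
  · rw [Polynomial.cyclotomic_six] at hroot
    simp only [Polynomial.IsRoot.def, Polynomial.eval_add, Polynomial.eval_sub,
      Polynomial.eval_pow, Polynomial.eval_X, Polynomial.eval_one] at hroot
    have : x + x⁻¹ = 1 := by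
      field_simp
      linear_combination hroot
    rw [this]
    exact K.one_mem

/-- For `k, n ≥ 3`, `ℚ(ζₖ + ζₖ⁻¹) ⊆ ℚ(ζₙ + ζₙ⁻¹)` iff `k ∈ {3,4,6}`, or `k ∣ n`, or
`k = 2d` with `d` odd and `d ∣ n`. -/
theorem stmt_9 (k n : ℕ) (hk : 3 ≤ k) (hn : 3 ≤ n) :
    let ζk : ℂ := Complex.exp (2 * Real.pi * Complex.I / k)
    let ζn : ℂ := Complex.exp (2 * Real.pi * Complex.I / n)
    (ℚ⟮ζk + ζk⁻¹⟯ : IntermediateField ℚ ℂ) ≤ ℚ⟮ζn + ζn⁻¹⟯ ↔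
      (k = 3 ∨ k = 4 ∨ k = 6) ∨ k ∣ n ∨ (∃ d : ℕ, Odd d ∧ k = 2 * d ∧ d ∣ n) := by
  intro ζk ζn
  have hζk : IsPrimitiveRoot ζk k := Complex.isPrimitiveRoot_exp k (by omega)
  have hζn : IsPrimitiveRoot ζn n := Complex.isPrimitiveRoot_exp n (by omega)
  have hζn0 : ζn ≠ 0 := hζn.ne_zero (by omega)
  rw [adjoin_simple_le_iff]
  constructor
  · intro hmem
    have hle : (ℚ⟮ζn + ζn⁻¹⟯ : IntermediateField ℚ ℂ) ≤ ℚ⟮ζn⟯ :=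
      adjoin_simple_le_iff.2 (add_mem (mem_adjoin_simple_self ℚ ζn)
        (inv_mem (mem_adjoin_simple_self ℚ ζn)))
    refine dvd_or_eq_two_mul_odd_of_units hk fun a ha hag => ?_
    obtain ⟨b, hbk, hbn⟩ := Nat.chineseRemainder' hag
    have hm : k.lcm n ≠ 0 := Nat.lcm_ne_zero (by omega) (by omega)
    obtain ⟨r, hr⟩ := Nat.dvd_lcm_left k n
    obtain ⟨s, hs⟩ := Nat.dvd_lcm_right k n
    have hbk' : b.Coprime k := by
      rw [Nat.Coprime, hbk.gcd_eq]
      exact ha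
    have hbn' : b.Coprime n := by
      rw [Nat.Coprime, hbn.gcd_eq]
      exact Nat.gcd_one_left n
    have hcop : b.Coprime (k.lcm n) :=
      (hbk'.mul_right hbn').coprime_dvd_right (Nat.lcm_dvd_mul k n)
    refine (modEq_one_or_dvd_add_one_of_add_inv_mem (Nat.pos_of_ne_zero hm)
      (Complex.isPrimitiveRoot_exp _ hm) hζk (by omega) hζn (by omega)
      (exp_two_pi_div_eq_pow hr hm) (exp_two_pi_div_eq_pow hs hm) (hle hmem) hcop hbn).imp
      hbk.symm.trans fun h => ?_
    exact (Nat.modEq_zero_iff_dvd).1 ((hbk.symm.add_right 1).trans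
      ((Nat.modEq_zero_iff_dvd).2 h))
  · have hself := mem_adjoin_simple_self ℚ (ζn + ζn⁻¹)
    rintro (h | ⟨r, hr⟩ | ⟨d, hd, hkd, r, hr⟩)
    · exact add_inv_mem_of_three_or_four_or_six _ hζk h
    · rw [show ζk = ζn ^ r from exp_two_pi_div_eq_pow hr (by omega)]
      exact pow_add_inv_pow_mem _ hζn0 hself r
    · have hhalf : ζk ^ d = -1 :=
        (hζk.pow (by omega) (hkd.trans (mul_comm 2 d))).eq_neg_one_of_two_right
      have hsq : ζk ^ 2 = ζn ^ r := by
        rw [← exp_two_pi_div_eq_pow hr (by omega)]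
        exact (exp_two_pi_div_eq_pow (hkd.trans (mul_comm 2 d)) (by omega)).symm
      obtain ⟨e, rfl⟩ := hd
      have hneg : ζk = -(ζn ^ (r * (e + 1))) := by
        rw [pow_mul, ← hsq, ← pow_mul, show 2 * (e + 1) = (2 * e + 1) + 1 by ring, pow_succ,
          hhalf]
        ring
      rw [hneg, inv_neg, ← neg_add]
      exact neg_mem (pow_add_inv_pow_mem _ hζn0 hself _)
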